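/- No partition is simultaneously of type 1 and of type 2. -/

import Mathlib

/-- A partition, 0-indexed: `f i` is the `(i+1)`-st part. A partition is a weakly
decreasing, eventually zero function `ℕ → ℕ`. -/
def IsPartition (f : ℕ → ℕ) : Prop := Antitone f ∧ ∃ N, f N = 0

/-- The number of (nonzero) parts of a partition. -/
noncomputable def plen (f : ℕ → ℕ) : ℕ := sInf {n | f n = 0}

/-- The size (weight) of a partition: the sum of its parts. -/
noncomputable def psize (f : ℕ → ℕ) : ℕ := ∑ i ∈ Finset.range (plen f), f i

/-- Containment of partitions: `subP f g` means `f ⊆ g`, i.e. `f i ≤ g i` for all `i`. -/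
def subP (f g : ℕ → ℕ) : Prop := ∀ i, f i ≤ g i

/-- The conjugate partition: `conjP f j = #{i : f i > j}` (0-indexed). -/
noncomputable def conjP (f : ℕ → ℕ) : ℕ → ℕ := fun j => Nat.card {i : ℕ // j < f i}

/-- The square partition `(s^s)`. -/
def squareP (s : ℕ) : ℕ → ℕ := fun j => if j < s then s else 0

/-- The partition `(s^s, 1)`: `s` parts equal to `s` followed by a part equal to `1`. -/
def squareP1 (s : ℕ) : ℕ → ℕ := fun j => if j < s then s else if j = s then 1 else 0

/-- The complement of `f` in the square `(m^m)`: the `(i+1)`-st part (0-indexed `i < m`)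
is `m - f (m - 1 - i)`. -/
def complP (m : ℕ) (f : ℕ → ℕ) : ℕ → ℕ := fun i => if i < m then m - f (m - 1 - i) else 0

/-- `ν + (1)`: add one box at the end of the first row. -/
def addRow1 (f : ℕ → ℕ) : ℕ → ℕ := fun j => if j = 0 then f 0 + 1 else f j

/-- `(ν, 1)`: append a part equal to `1` after the last nonzero part. -/
noncomputable def addPart1 (f : ℕ → ℕ) : ℕ → ℕ :=
  fun j => if j < plen f then f j else if j = plen f then 1 else 0

/-- Delete the first `k` columns of a partition. -/
def colDel (k : ℕ) (f : ℕ → ℕ) : ℕ → ℕ := fun j => f j - k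

/-- Delete the first `s` rows of a partition. -/
def rowDel (s : ℕ) (f : ℕ → ℕ) : ℕ → ℕ := fun j => f (j + s)

/-- The sequence whose first `m` entries are given by `f` and whose subsequent entries
are given by `g`; used to form `(η^{c,m} + γ, σ)`. -/
def appendAfter (m : ℕ) (f g : ℕ → ℕ) : ℕ → ℕ := fun i => if i < m then f i else g (i - m)

/-- The cell in row `r`, column `c` (both 0-indexed) belongs to the skew diagram
`lam/alpha`. -/
def inShape (lam alpha : ℕ → ℕ) (r c : ℕ) : Prop := alpha r ≤ c ∧ c < lam r

/-- A Littlewood–Richardson tableau of shape `lam/alpha` and content `beta`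
(for each `k`, there are `beta k` entries equal to `k + 1`): a semistandard filling of
the skew diagram whose reverse reading word is a lattice permutation.  The lattice
condition is expressed by comparing, in every prefix of the reverse reading word ending
at a cell `(r, c)` (all cells in rows above `r`, together with the cells in row `r`
weakly to the right of column `c`), the number of entries `k + 2` with the number of
entries `k + 1`. -/
structure LRTableau (lam alpha beta : ℕ → ℕ) where
  entry : ℕ → ℕ → ℕ
  zero_outside : ∀ r c, ¬ inShape lam alpha r c → entry r c = 0
  one_le : ∀ r c, inShape lam alpha r c → 1 ≤ entry r c
  row_weak : ∀ r c₁ c₂, c₁ ≤ c₂ → inShape lam alpha r c₁ → inShape lam alpha r c₂ →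
    entry r c₁ ≤ entry r c₂
  col_strict : ∀ r₁ r₂ c, r₁ < r₂ → inShape lam alpha r₁ c → inShape lam alpha r₂ c →
    entry r₁ c < entry r₂ c
  content : ∀ k : ℕ,
    Nat.card {p : ℕ × ℕ // inShape lam alpha p.1 p.2 ∧ entry p.1 p.2 = k + 1} = beta k
  lattice : ∀ r c k : ℕ, inShape lam alpha r c →
    Nat.card {p : ℕ × ℕ // inShape lam alpha p.1 p.2 ∧
        (p.1 < r ∨ (p.1 = r ∧ c ≤ p.2)) ∧ entry p.1 p.2 = k + 2} ≤
    Nat.card {p : ℕ × ℕ // inShape lam alpha p.1 p.2 ∧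
        (p.1 < r ∨ (p.1 = r ∧ c ≤ p.2)) ∧ entry p.1 p.2 = k + 1}

open Classical in
/-- The Littlewood–Richardson coefficient `c^lam_{alpha, beta}`: the number of LR
tableaux of shape `lam/alpha` and content `beta`, or `0` if `alpha ⊄ lam`. -/
noncomputable def LRcoeff (lam alpha beta : ℕ → ℕ) : ℕ :=
  if subP alpha lam then Nat.card (LRTableau lam alpha beta) else 0

/-- `mu` covers `nu`: for every integer `m ≥ μ₁ + ℓ(μ)` and every partition `lam`,
`c^lam_{ν^{c,m}, ν'} ≤ c^lam_{μ^{c,m}, μ'}`, i.e. `s_{μ'} s_{μ^c} - s_{ν'} s_{ν^c}`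
is Schur-positive (complements taken in `(m^m)`). -/
def Covers (mu nu : ℕ → ℕ) : Prop :=
  ∀ m : ℕ, mu 0 + plen mu ≤ m → ∀ lam : ℕ → ℕ, IsPartition lam →
    LRcoeff lam (complP m nu) (conjP nu) ≤ LRcoeff lam (complP m mu) (conjP mu)

/-- The partition `(i^{s+1}, i, i-1, ..., 2, 1)` (as a 0-indexed function). -/
def betaShape (i s : ℕ) : ℕ → ℕ := fun j => if j ≤ s + 1 then i else i + s + 1 - j

/-- A partition is of type 1 if it contains `(i, i, i-1, ..., 2, 1)` where `i` is its
first part. -/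
def Type1 (nu : ℕ → ℕ) : Prop := IsPartition nu ∧ subP (betaShape (nu 0) 0) nu

/-- `nu = beta + (s^s) + alpha` (componentwise) is a type-2 decomposition: `s ≥ 1`,
`alpha` is a nonempty partition with at most `s` parts, and `beta` is a (possibly empty)
partition containing `(i^{s+1}, i, i-1, ..., 2, 1)` where `i = beta 0`. -/
def IsType2Decomp (nu beta : ℕ → ℕ) (s : ℕ) (alpha : ℕ → ℕ) : Prop :=
  IsPartition beta ∧ IsPartition alpha ∧ 1 ≤ s ∧ alpha 0 ≠ 0 ∧ plen alpha ≤ s ∧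
    subP (betaShape (beta 0) s) beta ∧ ∀ j, nu j = beta j + squareP s j + alpha j

/-- A partition is of type 2 if it admits a type-2 decomposition. -/
def Type2 (nu : ℕ → ℕ) : Prop := ∃ beta s alpha, IsType2Decomp nu beta s alpha

/-- A self-conjugate partition. -/
def SelfConjugate (t : ℕ → ℕ) : Prop := ∀ j, conjP t j = t j

/-- A partition `nu` is corner-symmetric if for every outer corner of `nu` in row
`r + 1 ≥ 2` (1-indexed), i.e. every 0-indexed row `r ≥ 1` with `nu r < nu (r-1)`
(the corner cell lying in 0-indexed column `nu r`), there is a nonempty partition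
`η ⊆ nu` such that the skew diagram `nu/η` is, up to translation, the Young diagram of
a self-conjugate partition, contains the cell `(r-1, nu r)` (0-indexed), and contains
no cell in any column of 0-indexed column index `< nu r`. -/
def CornerSymmetric (nu : ℕ → ℕ) : Prop :=
  ∀ r : ℕ, 1 ≤ r → nu r < nu (r - 1) →
    ∃ η : ℕ → ℕ, IsPartition η ∧ subP η nu ∧ η 0 ≠ 0 ∧
      ∃ t : ℕ → ℕ, ∃ r0 c0 : ℕ, IsPartition t ∧ SelfConjugate t ∧
        (∀ a b : ℕ, (η a ≤ b ∧ b < nu a) ↔ (r0 ≤ a ∧ c0 ≤ b ∧ b - c0 < t (a - r0))) ∧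
        η (r - 1) ≤ nu r ∧
        (∀ a b : ℕ, η a ≤ b → b < nu a → nu r ≤ b)

/-- A partition vanishes at every index that is at least its number of parts. -/
theorem IsPartition.eq_zero_of_plen_le {f : ℕ → ℕ} (hf : IsPartition f) {n : ℕ}
    (hn : plen f ≤ n) : f n = 0 :=
  Nat.le_zero.mp ((hf.1 hn).trans_eq (Nat.sInf_mem (s := {n | f n = 0}) hf.2))

/-- no partition is simultaneously of type 1 and of type 2. -/
theorem not_type1_and_type2 (nu : ℕ → ℕ) : ¬ (Type1 nu ∧ Type2 nu) := by
  rintro ⟨⟨-, h₁⟩, β, s, α, hβ, hα, hs, hα0, hlen, -, hν⟩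
  have hαs : α s = 0 := hα.eq_zero_of_plen_le hlen
  have hβs : β s ≤ β 0 := hβ.1 s.zero_le
  have h0 : nu 0 = β 0 + s + α 0 := by simpa [squareP, Nat.lt_of_succ_le hs] using hν 0
  have hνs : nu s = β s := by simpa [squareP, hαs] using hν s
  have h := h₁ s
  unfold betaShape at h
  split_ifs at h <;> omega
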